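/- Let f : ℝ^d → [0,∞) satisfy f ≤ 1, f(0) = 1, and f(u) ≤ g(|u|) for a decreasing function g : [0,∞) → [0,∞) with ∫₀^∞ g(x)^α·x^{d-1} dx < ∞ for some α > 0. Then for each fixed t ∈ (0,∞], defining f^{(t)}(u) = f(u)·1{|u| < t}, one has ∫_{ℝ^d} sup_{v ∈ [0,L]^d} (f^{(t)}(v - u))^α du ∼ L^d as L → ∞ (the ratio tends to 1). -/

import Mathlib

open Filter MeasureTheory
open scoped ENNReal

/-- An arbitrary union of translates of a bounded convex set with nonempty interior is null
measurable. -/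
lemma nullMeasurableSet_union_translates {E : Type*} [NormedAddCommGroup E] [NormedSpace ℝ E]
    [FiniteDimensional ℝ E] [MeasurableSpace E] [BorelSpace E] (μ : Measure E)
    [μ.IsAddHaarMeasure] {S : Set E} (hS : Convex ℝ S) (hne : (interior S).Nonempty)
    (hb : Bornology.IsBounded S) (D : Set E) :
    NullMeasurableSet {z | ∃ w ∈ D, z + w ∈ S} μ := by
  set A := {z | ∃ w ∈ D, z + w ∈ S} with hA
  set U := {z | ∃ w ∈ D, z + w ∈ interior S} with hU
  have hUo : IsOpen U := by
    have : U = ⋃ w ∈ D, (fun z => z + w) ⁻¹' interior S := by ext; simp [hU]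
    rw [this]
    exact isOpen_biUnion fun w _ => isOpen_interior.preimage (by fun_prop)
  have hUA : U ⊆ A := fun z ⟨w, hw, h⟩ => ⟨w, hw, interior_subset h⟩
  obtain ⟨c, hc⟩ := hne
  obtain ⟨ρ, hρ, hball⟩ := Metric.nhds_basis_closedBall.mem_iff.1 (isOpen_interior.mem_nhds hc)
  obtain ⟨M, hM⟩ := hb.subset_closedBall c
  have hnull : ∀ᵐ x ∂μ.restrict Uᶜ, x ∉ A := by
    filter_upwards [IsUnifLocDoublingMeasure.ae_tendsto_measure_inter_div μ Uᶜ (M / ρ)] with x hx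
    rintro ⟨w, hw, hxw⟩
    have hs : ∀ j : ℕ, (0 : ℝ) < 1 / ((j : ℝ) + 1) := fun j => by positivity
    have hs1 : ∀ j : ℕ, 1 / ((j : ℝ) + 1) ≤ 1 := fun j => by
      rw [div_le_one (by positivity)]; linarith [(Nat.cast_nonneg j : (0 : ℝ) ≤ j)]
    have hlim := hx (l := atTop) (fun j : ℕ => x + (1 / ((j : ℝ) + 1)) • (c - w - x))
      (fun j : ℕ => (1 / ((j : ℝ) + 1)) * ρ) ?_ ?_
    · refine zero_ne_one (tendsto_nhds_unique (tendsto_const_nhds.congr fun j => ?_) hlim)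
      have hempty : Uᶜ ∩ Metric.closedBall (x + (1 / ((j : ℝ) + 1)) • (c - w - x))
          ((1 / ((j : ℝ) + 1)) * ρ) = ∅ := by
        rw [← Set.disjoint_iff_inter_eq_empty, Set.disjoint_compl_left_iff_subset]
        intro p hp
        refine ⟨w, hw, ?_⟩
        have hs0 := hs j
        have hs1 := hs1 j
        generalize 1 / ((j : ℝ) + 1) = s at *
        have hq : c + s⁻¹ • (p - (x + s • (c - w - x))) ∈ interior S := by
          refine hball ?_
          rw [mem_closedBall_iff_norm] at hp ⊢
          rw [add_sub_cancel_left, norm_smul, norm_inv, Real.norm_of_nonneg hs0.le,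
            inv_mul_le_iff₀ hs0]
          exact hp
        have := hS.combo_interior_self_mem_interior hq hxw hs0 (sub_nonneg.2 hs1) (by ring)
        convert this using 1
        rw [smul_add, smul_inv_smul₀ hs0.ne']
        module
      rw [hempty]; simp
    · refine tendsto_nhdsWithin_iff.2 ⟨?_, Eventually.of_forall fun j => ?_⟩
      · simpa using (tendsto_one_div_add_atTop_nhds_zero_nat (𝕜 := ℝ)).mul_const ρ
      · exact mul_pos (hs j) hρ
    · refine Eventually.of_forall fun j => ?_
      have h1 : ‖c - w - x‖ ≤ M := by
        have := hM hxw
        rw [Metric.mem_closedBall', dist_eq_norm] at this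
        rwa [sub_sub, add_comm w x]
      rw [Metric.mem_closedBall, dist_eq_norm, sub_add_cancel_left, norm_neg, norm_smul,
        Real.norm_of_nonneg (hs j).le]
      calc _ ≤ 1 / ((j : ℝ) + 1) * M := by gcongr
        _ = _ := by field_simp
  rw [ae_restrict_iff' hUo.measurableSet.compl] at hnull
  refine hUo.measurableSet.nullMeasurableSet.congr ?_
  filter_upwards [hnull] with x hx
  exact propext ⟨fun h => hUA h, fun h => by_contra fun h' => hx h' h⟩

lemma bddAbove_range_biSup {ι : Type*} {S : Set ι} {F : ι → ℝ} {M : ℝ} (hM : 0 ≤ M)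
    (hF : ∀ v ∈ S, F v ≤ M) : BddAbove (Set.range fun v => ⨆ (_ : v ∈ S), F v) :=
  ⟨M, by rintro _ ⟨v, rfl⟩; exact Real.iSup_le (hF v) hM⟩

lemma real_biSup_le {ι : Type*} {S : Set ι} {F : ι → ℝ} {M : ℝ} (hM : 0 ≤ M)
    (hF : ∀ v ∈ S, F v ≤ M) : ⨆ v ∈ S, F v ≤ M :=
  Real.iSup_le (fun v => Real.iSup_le (hF v) hM) hM

lemma le_real_biSup {ι : Type*} {S : Set ι} {F : ι → ℝ} {M : ℝ} (hM : 0 ≤ M)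
    (hF : ∀ v ∈ S, F v ≤ M) {v : ι} (hv : v ∈ S) : F v ≤ ⨆ v ∈ S, F v :=
  le_ciSup_of_le (bddAbove_range_biSup hM hF) v (ciSup_pos (f := fun _ => F v) hv).ge

lemma lt_real_biSup_iff {ι : Type*} {S : Set ι} {F : ι → ℝ} {M a : ℝ} (hM : 0 ≤ M)
    (hF : ∀ v ∈ S, F v ≤ M) (ha : 0 ≤ a) : a < ⨆ v ∈ S, F v ↔ ∃ v ∈ S, a < F v := by
  refine ⟨fun h => ?_, fun ⟨v, hv, h⟩ => h.trans_le (le_real_biSup hM hF hv)⟩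
  by_contra! h'
  exact h.not_ge (real_biSup_le ha h')

/-- The supremum of a bounded nonnegative function, measurable or not, over the translates of a
bounded convex set with nonempty interior is almost everywhere measurable in the translation. -/
lemma aemeasurable_biSup_translates {E : Type*} [NormedAddCommGroup E] [NormedSpace ℝ E]
    [FiniteDimensional ℝ E] [MeasurableSpace E] [BorelSpace E] (μ : Measure E)
    [μ.IsAddHaarMeasure] {S : Set E} (hS : Convex ℝ S) (hne : (interior S).Nonempty)
    (hb : Bornology.IsBounded S) {h : E → ℝ} (h0 : ∀ w, 0 ≤ h w) {M : ℝ} (hM : ∀ w, h w ≤ M) :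
    AEMeasurable (fun z => ⨆ v ∈ S, h (v - z)) μ := by
  have hM0 : 0 ≤ M := (h0 0).trans (hM 0)
  refine NullMeasurable.aemeasurable ?_
  refine @measurable_of_Ioi ℝ (NullMeasurableSpace E μ) _ _ _ _ _ _ _ _ fun a => ?_
  change NullMeasurableSet {z : E | a < ⨆ v ∈ S, h (v - z)} μ
  rcases lt_or_ge a 0 with ha | ha
  · have huniv : {z : E | a < ⨆ v ∈ S, h (v - z)} = Set.univ :=
      Set.eq_univ_of_forall fun z =>
        ha.trans_le (Real.iSup_nonneg fun v => Real.iSup_nonneg fun _ => h0 _)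
    rw [huniv]
    exact MeasurableSet.univ.nullMeasurableSet
  · suffices heq : {z : E | a < ⨆ v ∈ S, h (v - z)} = {z | ∃ w ∈ {w | a < h w}, z + w ∈ S} by
      rw [heq]
      exact nullMeasurableSet_union_translates μ hS hne hb {w | a < h w}
    ext z
    rw [Set.mem_ofPred_eq, Set.mem_ofPred_eq, lt_real_biSup_iff hM0 (fun _ _ => hM _) ha]
    constructor
    · rintro ⟨v, hv, hav⟩
      exact ⟨v - z, hav, by simpa using hv⟩
    · rintro ⟨w, hw, hzw⟩
      exact ⟨z + w, hzw, by simpa using hw⟩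

lemma volume_unit_cube (d : ℕ) :
    volume {v : EuclideanSpace ℝ (Fin d) | ∀ i, v i ∈ Set.Icc (0 : ℝ) 1} = 1 := by
  have h := (PiLp.volume_preserving_ofLp (Fin d)).measure_preimage
    (s := Set.Icc (0 : Fin d → ℝ) 1) measurableSet_Icc.nullMeasurableSet
  rw [Real.volume_Icc_pi] at h
  simp only [Pi.one_apply, Pi.zero_apply, sub_zero, ENNReal.ofReal_one, Finset.prod_const_one] at h
  rw [← h]
  congr 1
  ext v
  simp [Pi.le_def, forall_and]

lemma isClosed_unit_cube (d : ℕ) :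
    IsClosed {v : EuclideanSpace ℝ (Fin d) | ∀ i, v i ∈ Set.Icc (0 : ℝ) 1} := by
  simp only [Set.ofPred_forall]
  exact isClosed_iInter fun i => isClosed_Icc.preimage (by fun_prop)

lemma convex_unit_cube (d : ℕ) :
    Convex ℝ {v : EuclideanSpace ℝ (Fin d) | ∀ i, v i ∈ Set.Icc (0 : ℝ) 1} := by
  intro x hx y hy a b ha hb hab i
  exact (convex_Icc (0 : ℝ) 1) (hx i) (hy i) ha hb hab

lemma norm_le_of_mem_unit_cube {d : ℕ} {v : EuclideanSpace ℝ (Fin d)}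
    (hv : ∀ i, v i ∈ Set.Icc (0 : ℝ) 1) : ‖v‖ ≤ d := by
  rw [EuclideanSpace.norm_eq]
  refine Real.sqrt_le_iff.2 ⟨by positivity, ?_⟩
  calc ∑ i, ‖v i‖ ^ 2 ≤ ∑ _i : Fin d, (1 : ℝ) := by
        gcongr with i
        rw [Real.norm_of_nonneg (hv i).1]
        exact pow_le_one₀ (hv i).1 (hv i).2
    _ = d := by simp
    _ ≤ (d : ℝ) ^ 2 := by exact_mod_cast Nat.le_self_pow (by norm_num) d

lemma interior_unit_cube_nonempty (d : ℕ) :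
    (interior {v : EuclideanSpace ℝ (Fin d) | ∀ i, v i ∈ Set.Icc (0 : ℝ) 1}).Nonempty := by
  have ho : IsOpen {v : EuclideanSpace ℝ (Fin d) | ∀ i, v i ∈ Set.Ioo (0 : ℝ) 1} := by
    simp only [Set.ofPred_forall]
    exact isOpen_iInter_of_finite fun i => isOpen_Ioo.preimage (by fun_prop)
  have hsub : {v : EuclideanSpace ℝ (Fin d) | ∀ i, v i ∈ Set.Ioo (0 : ℝ) 1} ⊆
      {v | ∀ i, v i ∈ Set.Icc (0 : ℝ) 1} := fun v hv i => Set.Ioo_subset_Icc_self (hv i)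
  refine ⟨WithLp.toLp 2 fun _ => 1 / 2, interior_maximal hsub ho fun i => ?_⟩
  norm_num

/-- A nonnegative antitone function with `g ^ α * x ^ n` integrable at infinity tends to zero. -/
lemma exists_lt_of_integrableOn_rpow_mul_pow {g : ℝ → ℝ} {α : ℝ} {n : ℕ} (hα : 0 < α)
    (hint : IntegrableOn (fun x => g x ^ α * x ^ n) (Set.Ioi (0 : ℝ))) {ε : ℝ} (hε : 0 < ε) :
    ∃ x, 0 < x ∧ g x < ε := by
  by_contra! h
  have h1 : IntegrableOn (fun _ : ℝ => ε ^ α) (Set.Ioi (1 : ℝ)) := by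
    refine Integrable.mono' (hint.mono_set (Set.Ioi_subset_Ioi zero_le_one))
      aestronglyMeasurable_const ?_
    filter_upwards [ae_restrict_mem measurableSet_Ioi] with x hx
    have hx1 : (1 : ℝ) < x := hx
    rw [Real.norm_of_nonneg (by positivity)]
    calc ε ^ α ≤ g x ^ α := Real.rpow_le_rpow hε.le (h x (by linarith)) hα.le
      _ ≤ g x ^ α * x ^ n := le_mul_of_one_le_right
        (Real.rpow_nonneg (hε.le.trans (h x (by linarith))) _) (one_le_pow₀ hx1.le)
  rw [integrableOn_const_iff (by simp)] at h1
  rcases h1 with h1 | h1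
  · exact (Real.rpow_pos_of_pos hε α).ne' (enorm_eq_zero.1 h1)
  · simp at h1

theorem truncated_kernel_integral_asymptotics
    (d : ℕ) (hd : 0 < d) (α : ℝ) (hα : 0 < α)
    (f : EuclideanSpace ℝ (Fin d) → ℝ)
    (hf0 : ∀ u, 0 ≤ f u) (hf1 : ∀ u, f u ≤ 1) (hfzero : f 0 = 1)
    (g : ℝ → ℝ) (hg0 : ∀ x, 0 ≤ g x) (hgmono : AntitoneOn g (Set.Ici 0))
    (hfg : ∀ u, f u ≤ g ‖u‖)
    (hint : IntegrableOn (fun x => g x ^ α * x ^ (d - 1)) (Set.Ioi (0 : ℝ)))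
    (t : ℝ≥0∞) (ht : 0 < t) :
    Tendsto (fun L : ℝ =>
      (∫ u, ⨆ v ∈ {v : EuclideanSpace ℝ (Fin d) | ∀ i, v i ∈ Set.Icc 0 L},
          (if (‖v - u‖₊ : ℝ≥0∞) < t then f (v - u) else 0) ^ α) / L ^ d)
      atTop (nhds 1) := by
  set h : EuclideanSpace ℝ (Fin d) → ℝ :=
    fun w => (if (‖w‖₊ : ℝ≥0∞) < t then f w else 0) ^ α with hh
  have hb0 : ∀ w, 0 ≤ if (‖w‖₊ : ℝ≥0∞) < t then f w else 0 := fun w => by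
    split_ifs
    exacts [hf0 w, le_rfl]
  have hbf : ∀ w, (if (‖w‖₊ : ℝ≥0∞) < t then f w else 0) ≤ f w := fun w => by
    split_ifs
    exacts [le_rfl, hf0 w]
  have h0 : ∀ w, 0 ≤ h w := fun w => Real.rpow_nonneg (hb0 w) _
  have h1 : ∀ w, h w ≤ 1 := fun w =>
    Real.rpow_le_one (hb0 w) ((hbf w).trans (hf1 w)) hα.le
  have hzero : h 0 = 1 := by simp [hh, ht, hfzero]
  have hhg : ∀ w r, 0 ≤ r → r ≤ ‖w‖ → h w ≤ g r ^ α := fun w r hr hrw =>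
    Real.rpow_le_rpow (hb0 w) (((hbf w).trans (hfg w)).trans
      (hgmono hr (hr.trans hrw) hrw)) hα.le
  set C := {v : EuclideanSpace ℝ (Fin d) | ∀ i, v i ∈ Set.Icc (0 : ℝ) 1} with hC
  set G : ℝ → EuclideanSpace ℝ (Fin d) → ℝ := fun L z => ⨆ v ∈ C, h (L • (v - z)) with hG
  have hbdd : Bornology.IsBounded C := (Metric.isBounded_closedBall (x := 0) (r := (d : ℝ))).subset
    fun v hv => by simpa using norm_le_of_mem_unit_cube hv
  have hG0 : ∀ L z, 0 ≤ G L z := fun L z =>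
    Real.iSup_nonneg fun v => Real.iSup_nonneg fun _ => h0 _
  have hscale : ∀ L : ℝ, 0 < L → (∫ u, ⨆ v ∈ {v : EuclideanSpace ℝ (Fin d) |
      ∀ i, v i ∈ Set.Icc 0 L}, h (v - u)) / L ^ d = ∫ z, G L z := by
    intro L hL
    have hz : ∀ z, G L z =
        ⨆ v ∈ {v : EuclideanSpace ℝ (Fin d) | ∀ i, v i ∈ Set.Icc 0 L}, h (v - L • z) := by
      intro z
      apply le_antisymm
      · refine real_biSup_le (Real.iSup_nonneg fun v => Real.iSup_nonneg fun _ => h0 _)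
          fun v hv => ?_
        rw [smul_sub]
        refine le_real_biSup (F := fun v => h (v - L • z)) zero_le_one (fun _ _ => h1 _)
          (fun i => ⟨?_, ?_⟩)
        · exact mul_nonneg hL.le (hv i).1
        · exact mul_le_of_le_one_right hL.le (hv i).2
      · refine real_biSup_le (hG0 L z) fun v hv => ?_
        have : v - L • z = L • (L⁻¹ • v - z) := by rw [smul_sub, smul_inv_smul₀ hL.ne']
        rw [this]
        refine le_real_biSup (F := fun v => h (L • (v - z))) zero_le_one (fun _ _ => h1 _)
          (fun i => ⟨?_, ?_⟩)
        · exact mul_nonneg (inv_nonneg.2 hL.le) (hv i).1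
        · exact (inv_mul_le_one₀ hL).2 (hv i).2
    simp_rw [hz]
    rw [Measure.integral_comp_smul volume (fun u => ⨆ v ∈ {v : EuclideanSpace ℝ (Fin d) |
      ∀ i, v i ∈ Set.Icc 0 L}, h (v - u)) L, finrank_euclideanSpace_fin,
      abs_of_pos (by positivity), smul_eq_mul, div_eq_inv_mul]
  have hlim : Tendsto (fun L => ∫ z, G L z) atTop (nhds (∫ z, C.indicator 1 z)) := by
    refine tendsto_integral_filter_of_dominated_convergence
      (fun z => (Metric.closedBall 0 (2 * d)).indicator 1 z + g ‖(2⁻¹ : ℝ) • z‖ ^ α) ?_ ?_ ?_ ?_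
    · refine Eventually.of_forall fun L => AEMeasurable.aestronglyMeasurable ?_
      exact aemeasurable_biSup_translates volume (convex_unit_cube d)
        (interior_unit_cube_nonempty d) hbdd (h := fun w => h (L • w)) (fun w => h0 _)
        (fun w => h1 _)
    · filter_upwards [eventually_ge_atTop 1] with L hL
      refine Eventually.of_forall fun z => ?_
      rw [Real.norm_of_nonneg (hG0 L z)]
      have hgz : 0 ≤ g ‖(2⁻¹ : ℝ) • z‖ ^ α := Real.rpow_nonneg (hg0 _) _
      by_cases hz : z ∈ Metric.closedBall (0 : EuclideanSpace ℝ (Fin d)) (2 * d)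
      · rw [Set.indicator_of_mem hz]
        exact (real_biSup_le zero_le_one fun _ _ => h1 _).trans (le_add_of_nonneg_right hgz)
      · rw [Set.indicator_of_notMem hz, zero_add]
        refine real_biSup_le hgz fun v hv => hhg _ _ (norm_nonneg _) ?_
        rw [mem_closedBall_zero_iff, not_le] at hz
        have hv' := norm_le_of_mem_unit_cube hv
        have h2 := norm_sub_norm_le z v
        rw [norm_sub_rev] at h2
        rw [norm_smul, norm_smul, Real.norm_of_nonneg (by linarith : (0 : ℝ) ≤ L)]
        norm_num
        nlinarith [norm_nonneg (v - z)]
    · have : Nonempty (Fin d) := ⟨⟨0, hd⟩⟩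
      refine Integrable.add ?_ ?_
      · exact (integrable_indicator_iff measurableSet_closedBall).2
          (integrableOn_const (C := (1 : ℝ)) measure_closedBall_lt_top.ne)
      · refine Integrable.comp_smul (f := fun z : EuclideanSpace ℝ (Fin d) => g ‖z‖ ^ α) ?_
          (by norm_num)
        rw [integrable_fun_norm_addHaar volume (f := fun x => g x ^ α),
          finrank_euclideanSpace_fin]
        simpa only [smul_eq_mul, mul_comm] using hint
    · refine Eventually.of_forall fun z => ?_
      by_cases hz : z ∈ C
      · rw [Set.indicator_of_mem hz]
        refine tendsto_const_nhds.congr fun L => le_antisymm ?_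
          (real_biSup_le zero_le_one fun _ _ => h1 _)
        have := le_real_biSup (F := fun v => h (L • (v - z))) zero_le_one (fun _ _ => h1 _) hz
        simpa [hzero] using this
      · rw [Set.indicator_of_notMem hz]
        obtain ⟨r, hr, hrC⟩ := Metric.nhds_basis_ball.mem_iff.1
          ((isClosed_unit_cube d).isOpen_compl.mem_nhds hz)
        refine tendsto_order.2 ⟨fun a ha => Eventually.of_forall fun L => ha.trans_le (hG0 L z),
          fun ε hε => ?_⟩
        obtain ⟨x, hx, hgx⟩ := exists_lt_of_integrableOn_rpow_mul_pow hα hint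
          (Real.rpow_pos_of_pos hε α⁻¹)
        have hgx' : g x ^ α < ε := by
          have := Real.rpow_lt_rpow (hg0 x) hgx hα
          rwa [Real.rpow_inv_rpow hε.le hα.ne'] at this
        filter_upwards [eventually_ge_atTop (x / r)] with L hL
        refine lt_of_le_of_lt (real_biSup_le (Real.rpow_nonneg (hg0 x) α) fun v hv =>
          hhg _ x hx.le ?_) hgx'
        have hvr : r ≤ ‖v - z‖ := by
          by_contra! hlt
          exact hrC (mem_ball_iff_norm.2 hlt) hv
        have hL0 : 0 ≤ L := (by positivity : 0 ≤ x / r).trans hL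
        rw [norm_smul, Real.norm_of_nonneg hL0]
        calc x = x / r * r := by field_simp
          _ ≤ L * ‖v - z‖ := by gcongr
  have hone : ∫ z, C.indicator (1 : EuclideanSpace ℝ (Fin d) → ℝ) z = 1 := by
    rw [integral_indicator_one (isClosed_unit_cube d).measurableSet, measureReal_def,
      volume_unit_cube, ENNReal.toReal_one]
  rw [hone] at hlim
  refine hlim.congr' ?_
  filter_upwards [eventually_gt_atTop 0] with L hL
  exact (hscale L hL).symm
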